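/- In the hyperquotient setup with the cD–E form and Rules I and II, assume moreover that $a\equiv 0$, $c\equiv -b$, $d\equiv 1$, $e\equiv 0 \pmod r$ and $b$ is coprime to $r$ (type $\frac{1}{r}(0,b,-b,1;0)$). Then for every integer $k$ with $1\leq k\leq r-1$ such that either $B=\emptyset$ or the element $\beta$ of $B$ satisfies $\beta\not\equiv\alpha_k \pmod{\mathbb{Z}^4}$, one has $\inf_{m\in G}\frac{1}{r}\big(m_2\,\overline{bk}+m_3\,\overline{-bk}+m_4\,k\big)=1$. -/

import Mathlib

open scoped BigOperators

namespace GapPaper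

/-- Least non-negative residue of `n` modulo `r` (for `r > 0`). -/
def res (r n : ℤ) : ℤ := n % r

/-- The lattice `N = ℤ⁴ + ℤ·(1/r)(a,b,c,d)` inside `ℚ⁴`. -/
def latN (r a b c d : ℤ) : Set (Fin 4 → ℚ) :=
  {v | ∃ (j : ℤ) (m : Fin 4 → ℤ), ∀ i,
    v i = ((j * ![a, b, c, d] i : ℤ) : ℚ) / (r : ℚ) + (m i : ℚ)}

/-- The positive orthant `σ`. -/
def orth : Set (Fin 4 → ℚ) := {v | ∀ i, 0 ≤ v i}

/-- The weight `w(v) = v₁ + v₂ + v₃ + v₄`. -/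
def w (v : Fin 4 → ℚ) : ℚ := ∑ i, v i

/-- `v(f)`: the infimum over the monomials `m ∈ S` of their `v`-weights. -/
noncomputable def vf (S : Set (Fin 4 → ℕ)) (v : Fin 4 → ℚ) : ℝ :=
  sInf {x : ℝ | ∃ m ∈ S, x = ∑ i : Fin 4, (m i : ℝ) * ((v i : ℚ) : ℝ)}

/-- `v` is primitive in the lattice `N`. -/
def IsPrim (r a b c d : ℤ) (v : Fin 4 → ℚ) : Prop :=
  ¬ ∃ (n : ℤ) (u : Fin 4 → ℚ), 2 ≤ n ∧ u ∈ latN r a b c d ∧ v = fun i => (n : ℚ) * u i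

/-- The excluded set `{0, e₁, e₂, e₃, e₄}`. -/
def corners : Set (Fin 4 → ℚ) :=
  {v | v = 0 ∨ ∃ i₀ : Fin 4, v = fun i => if i = i₀ then 1 else 0}

/-- Every monomial of `S` has weight `e` for the `μ_r`-action with weights
`(a, b, c, d)`. -/
def WeightCond (r a b c d e : ℤ) (S : Set (Fin 4 → ℕ)) : Prop :=
  ∀ m ∈ S, Int.ModEq r ((m 0 : ℤ) * a + (m 1 : ℤ) * b + (m 2 : ℤ) * c + (m 3 : ℤ) * d) e

/-- Rule I: `B` is a set with at most one element, whose element `β` (if any) is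
primitive and satisfies `1 - δ < w(β) - β(f) < 1`, and every lattice vector in the
orthant other than `β`, `0`, `e₁`, ..., `e₄` satisfies `w(v) - v(f) > 1`. -/
def RuleI (r a b c d : ℤ) (δ : ℝ) (S : Set (Fin 4 → ℕ)) (B : Set (Fin 4 → ℚ)) : Prop :=
  B.Subsingleton ∧ B ⊆ latN r a b c d ∩ orth ∧
    (∀ β ∈ B, IsPrim r a b c d β ∧
      1 - δ < ((w β : ℚ) : ℝ) - vf S β ∧ ((w β : ℚ) : ℝ) - vf S β < 1) ∧
    ∀ v ∈ latN r a b c d ∩ orth, v ∉ B → v ∉ corners → 1 < ((w v : ℚ) : ℝ) - vf S v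

/-- Rule II. -/
def RuleII (r a b c d e : ℤ) : Prop :=
  (Int.gcd a r ∣ Int.gcd e r) ∧ (Int.gcd b r ∣ Int.gcd e r) ∧
  (Int.gcd c r ∣ Int.gcd e r) ∧ (Int.gcd d r ∣ Int.gcd e r) ∧
  Int.gcd a (Int.gcd b r) = 1 ∧ Int.gcd a (Int.gcd c r) = 1 ∧
  Int.gcd a (Int.gcd d r) = 1 ∧ Int.gcd b (Int.gcd c r) = 1 ∧
  Int.gcd b (Int.gcd d r) = 1 ∧ Int.gcd c (Int.gcd d r) = 1 ∧
  Int.ModEq r (a + b + c + d - e) 1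

/-- The vector `α_k = (1/r)(res(ak), res(bk), res(ck), res(dk))`. -/
def alphaK (r a b c d k : ℤ) : Fin 4 → ℚ :=
  fun i => ((res r (![a, b, c, d] i * k) : ℤ) : ℚ) / (r : ℚ)

/-- The unit cube `[0,1]⁴` minus its 16 vertices. -/
def cube : Set (Fin 4 → ℚ) :=
  {v | (∀ i, 0 ≤ v i ∧ v i ≤ 1) ∧ ¬ ∀ i, v i = 0 ∨ v i = 1}

/-- The cA form: `f = xy + g(z,t)` with `g ∈ 𝔪²`. -/
def FormCA (S : Set (Fin 4 → ℕ)) : Prop :=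
  ![1, 1, 0, 0] ∈ S ∧
    ∀ m ∈ S, m ≠ ![1, 1, 0, 0] → m 0 = 0 ∧ m 1 = 0 ∧ 2 ≤ m 2 + m 3

/-- The square form: `f = x² + (terms of order ≥ 2)`. -/
def FormSq (S : Set (Fin 4 → ℕ)) : Prop :=
  ![2, 0, 0, 0] ∈ S ∧ ∀ m ∈ S, 2 ≤ m 0 + m 1 + m 2 + m 3

/-- The odd form: `f = x² + y² + g(z,t)` with `g ∈ 𝔪³`. -/
def FormOdd (S : Set (Fin 4 → ℕ)) : Prop :=
  ![2, 0, 0, 0] ∈ S ∧ ![0, 2, 0, 0] ∈ S ∧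
    ∀ m ∈ S, m ≠ ![2, 0, 0, 0] → m ≠ ![0, 2, 0, 0] →
      m 0 = 0 ∧ m 1 = 0 ∧ 3 ≤ m 2 + m 3

/-- The cD–E form: `f = x² + g(y,z,t)` with `g ∈ 𝔪³`. -/
def FormCDE (S : Set (Fin 4 → ℕ)) : Prop :=
  ![2, 0, 0, 0] ∈ S ∧ ∀ m ∈ S, m ≠ ![2, 0, 0, 0] → m 0 = 0 ∧ 3 ≤ m 1 + m 2 + m 3

/-- The Claim in case (a) of the cD–E analysis: for type `(1/r)(0, b, -b, 1; 0)`,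
for every `k` with `α_k ≢ β (mod ℤ⁴)`, the weight `α_k(g)` equals `1`. -/
theorem statement18 (r : ℤ) (δ : ℝ) (a b c d e : ℤ)
    (S G : Set (Fin 4 → ℕ)) (B : Set (Fin 4 → ℚ))
    (hr : 13 < r) (hδ0 : 0 < δ) (hδ1 : δ ≤ 1 / 13)
    (hwt : WeightCond r a b c d e S)
    (hI : RuleI r a b c d δ S B) (hII : RuleII r a b c d e)
    (hS : S = insert ![2, 0, 0, 0] G)
    (hG : ∀ m ∈ G, m 0 = 0 ∧ 3 ≤ m 1 + m 2 + m 3)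
    (ha : Int.ModEq r a 0) (hc : Int.ModEq r c (-b)) (hd : Int.ModEq r d 1)
    (he : Int.ModEq r e 0) (hb : Int.gcd b r = 1) :
    ∀ k : ℤ, 1 ≤ k → k ≤ r - 1 →
      (∀ β ∈ B, ¬ ∃ m : Fin 4 → ℤ, ∀ i, β i = alphaK r a b c d k i + (m i : ℚ)) →
      sInf {x : ℝ | ∃ m ∈ G, x = (1 / (r : ℝ)) *
        ((m 1 : ℝ) * ((res r (b * k) : ℤ) : ℝ) +
          (m 2 : ℝ) * ((res r (-b * k) : ℤ) : ℝ) + (m 3 : ℝ) * (k : ℝ))} = 1 := by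
  intro k hk1 hk2 hβ
  obtain ⟨-, -, -, hI4⟩ := hI
  have hr0 : (0 : ℤ) < r := by omega
  have hrR : (0 : ℝ) < (r : ℝ) := by exact_mod_cast hr0
  have hrQ : (0 : ℚ) < (r : ℚ) := by exact_mod_cast hr0
  -- residues
  obtain ⟨Y, hY⟩ : ∃ Y, Y = res r (b * k) := ⟨_, rfl⟩
  obtain ⟨Z, hZ⟩ : ∃ Z, Z = res r (-b * k) := ⟨_, rfl⟩
  have e0 : res r (a * k) = 0 := by
    have : a * k ≡ 0 * k [ZMOD r] := ha.mul_right k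
    simpa [res, Int.ModEq] using this
  have e2 : res r (c * k) = Z := by
    rw [hZ]; exact hc.mul_right k
  have e3 : res r (d * k) = k := by
    have : d * k ≡ 1 * k [ZMOD r] := hd.mul_right k
    unfold res
    rw [this, one_mul, Int.emod_eq_of_lt (by omega) (by omega)]
  have hndvd : ¬ r ∣ b * k := by
    intro h
    have hco : IsCoprime r b := by
      rw [Int.isCoprime_iff_gcd_eq_one, Int.gcd_comm]; exact hb
    have := Int.le_of_dvd (by omega) (hco.dvd_of_dvd_mul_left h)
    omega
  have hY0 : 0 < Y := by
    have h1 := Int.emod_nonneg (b * k) hr0.ne'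
    have h2 : b * k % r ≠ 0 := fun h => hndvd (Int.dvd_of_emod_eq_zero h)
    rw [hY]; unfold res; omega
  have hYr : Y < r := by rw [hY]; exact Int.emod_lt_of_pos _ hr0
  have hYd : r ∣ b * k - Y := by rw [hY]; exact Int.dvd_self_sub_emod
  have hZd : r ∣ -b * k - Z := by rw [hZ]; exact Int.dvd_self_sub_emod
  have hZ0' : 0 ≤ Z := by rw [hZ]; exact Int.emod_nonneg _ hr0.ne'
  have hZr : Z < r := by rw [hZ]; exact Int.emod_lt_of_pos _ hr0
  have hYZ : Y + Z = r := by
    have hd1 : r ∣ Y + Z := by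
      have := dvd_add hYd hZd
      have h2 : (b * k - Y) + (-b * k - Z) = -(Y + Z) := by ring
      rw [h2] at this
      exact (dvd_neg).1 this
    obtain ⟨q, hq⟩ := hd1
    have : q = 1 := by
      have : 0 < q := by
        by_contra hc; nlinarith
      have : q < 2 := by
        by_contra hc; nlinarith
      omega
    rw [hq, this, mul_one]
  have hZ0 : 0 < Z := by omega
  -- integrality
  have hint : ∀ m ∈ G, ∃ q : ℤ, 1 ≤ q ∧ (m 1 : ℤ) * Y + (m 2 : ℤ) * Z + (m 3 : ℤ) * k = r * q := by
    intro m hm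
    obtain ⟨hm0, hm3⟩ := hG m hm
    have hw := hwt m (by rw [hS]; exact Set.mem_insert_of_mem _ hm)
    have hdv : r ∣ (m 1 : ℤ) * Y + (m 2 : ℤ) * Z + (m 3 : ℤ) * k := by
      rw [← Int.modEq_zero_iff_dvd]
      have y1 : Y ≡ b * k [ZMOD r] := (Int.modEq_iff_dvd).2 hYd
      have z1 : Z ≡ -b * k [ZMOD r] := (Int.modEq_iff_dvd).2 hZd
      have hd' : k ≡ d * k [ZMOD r] := by simpa using (hd.symm.mul_right k)
      have z2 : Z ≡ c * k [ZMOD r] := z1.trans (hc.symm.mul_right k)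
      have t := ((y1.mul_left (m 1 : ℤ)).add (z2.mul_left (m 2 : ℤ))).add (hd'.mul_left (m 3 : ℤ))
      refine t.trans ?_
      have u := (hw.trans he).mul_right k
      rw [hm0] at u
      have h3 : ((0 : ℕ) : ℤ) * a + (m 1 : ℤ) * b + (m 2 : ℤ) * c + (m 3 : ℤ) * d
        = (m 1 : ℤ) * b + (m 2 : ℤ) * c + (m 3 : ℤ) * d := by simp
      rw [h3, zero_mul] at u
      convert u using 1
      ring
    obtain ⟨q, hq⟩ := hdv
    refine ⟨q, ?_, hq⟩
    have hpos : 0 < (m 1 : ℤ) * Y + (m 2 : ℤ) * Z + (m 3 : ℤ) * k := by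
      have h1 : (m 1 : ℤ) * 1 ≤ (m 1 : ℤ) * Y := mul_le_mul_of_nonneg_left (by omega) (by positivity)
      have h2 : (m 2 : ℤ) * 1 ≤ (m 2 : ℤ) * Z := mul_le_mul_of_nonneg_left (by omega) (by positivity)
      have h3 : (m 3 : ℤ) * 1 ≤ (m 3 : ℤ) * k := mul_le_mul_of_nonneg_left (by omega) (by positivity)
      omega
    rw [hq] at hpos
    have := pos_of_mul_pos_right hpos hr0.le
    omega
  have hval : ∀ (m : Fin 4 → ℕ) (q : ℤ),
      (m 1 : ℤ) * Y + (m 2 : ℤ) * Z + (m 3 : ℤ) * k = r * q →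
      (1 / (r : ℝ)) * ((m 1 : ℝ) * (Y : ℝ) + (m 2 : ℝ) * (Z : ℝ) + (m 3 : ℝ) * (k : ℝ)) = q := by
    intro m q h
    have h' : (m 1 : ℝ) * (Y : ℝ) + (m 2 : ℝ) * (Z : ℝ) + (m 3 : ℝ) * (k : ℝ) = r * q := by
      exact_mod_cast h
    rw [h']; field_simp
  rw [← hY, ← hZ]
  -- the test vector
  let v : Fin 4 → ℚ := ![1, (Y : ℚ) / r, (Z : ℚ) / r, (k : ℚ) / r]
  have hvα : ∀ i, v i = alphaK r a b c d k i + ((![1, 0, 0, 0] : Fin 4 → ℤ) i : ℚ) := by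
    intro i
    fin_cases i <;> simp [v, alphaK, e0, e2, e3, ← hY]
  have hvB : v ∉ B := fun h => hβ v h ⟨_, hvα⟩
  have hvN : v ∈ latN r a b c d := by
    refine ⟨k, fun i => (![1, 0, 0, 0] : Fin 4 → ℤ) i - (![a, b, c, d] i * k) / r, fun i => ?_⟩
    rw [hvα i]
    unfold alphaK res
    beta_reduce
    generalize ![a, b, c, d] i = n
    have h := Int.emod_add_mul_ediv (n * k) r
    have h' : (((n * k % r : ℤ)) : ℚ) + r * ((n * k / r : ℤ) : ℚ) = ((k * n : ℤ) : ℚ) := by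
      rw [mul_comm k n]; exact_mod_cast h
    rw [← h']
    push_cast
    field_simp
    ring
  have hvO : v ∈ orth := by
    intro i
    have h1 : (0 : ℚ) ≤ Y := by exact_mod_cast hY0.le
    have h2 : (0 : ℚ) ≤ Z := by exact_mod_cast hZ0.le
    have h3 : (0 : ℚ) ≤ k := by exact_mod_cast (by omega : (0 : ℤ) ≤ k)
    fin_cases i <;> simp [v] <;> positivity
  have hvC : v ∉ corners := by
    have h1 : 0 < v 1 := by
      have : (0 : ℚ) < Y := by exact_mod_cast hY0
      simp only [v, Matrix.cons_val_one, Matrix.cons_val_zero]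
      positivity
    have h0 : v 0 = 1 := rfl
    rintro (h | ⟨i, h⟩)
    · rw [h] at h1; simp at h1
    · rw [h] at h0 h1
      by_cases hi : (0 : Fin 4) = i
      · subst hi; simp at h1
      · simp [hi] at h0
  have hmain := hI4 v ⟨hvN, hvO⟩ hvB hvC
  have hwv : ((w v : ℚ) : ℝ) = 2 + k / r := by
    have h : (Y : ℝ) + Z = r := by exact_mod_cast hYZ
    have h2 : (Y : ℝ) / r + (Z : ℝ) / r = 1 := by rw [← add_div, h, div_self hrR.ne']
    simp only [w, v, Fin.sum_univ_four]
    simp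
    linarith
  have hkr : (k : ℝ) / r < 1 := by
    rw [div_lt_one hrR]; exact_mod_cast (by omega : k < r)
  have hex : ∃ m ∈ G, (m 1 : ℤ) * Y + (m 2 : ℤ) * Z + (m 3 : ℤ) * k = r * 1 := by
    by_contra hne
    push Not at hne
    have h2 : 2 ≤ vf S v := by
      apply le_csInf
      · exact ⟨_, ![2, 0, 0, 0], by rw [hS]; exact Set.mem_insert _ _, rfl⟩
      · rintro x ⟨m, hm, rfl⟩
        rw [hS] at hm
        rcases hm with rfl | hm
        · simp [Fin.sum_univ_four, v]
        · obtain ⟨q, hq1, hq⟩ := hint m hm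
          have hq2 : q ≠ 1 := by
            rintro rfl; exact hne m hm hq
          have hq3 : (2 : ℝ) ≤ q := by exact_mod_cast (by omega : 2 ≤ q)
          rw [← hval m q hq] at hq3
          refine hq3.trans (le_of_eq ?_)
          simp [Fin.sum_univ_four, v, (hG m hm).1]
          ring
    linarith
  apply IsLeast.csInf_eq
  constructor
  · obtain ⟨m, hm, h⟩ := hex
    exact ⟨m, hm, by rw [hval m 1 h]; simp⟩
  · rintro x ⟨m, hm, rfl⟩
    obtain ⟨q, hq1, hq⟩ := hint m hm
    rw [hval m q hq]
    exact_mod_cast hq1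

end GapPaper
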